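/- arXiv:2006.15885 — 2 statements merged into one kernel-verified Lean document; each statement's English description precedes it below -/
import Mathlib

section
/- Let f : ℝ³ → ℝ be smooth with compact support and let ψ(z) = ‖z‖. Then for every v ∈ ℝ³, Δ(ψ⋆f)(v) = ∫_{ℝ³} (2/‖v−w‖) f(w) dw; that is, the Laplacian of the Rosenbluth potential of f equals the convolution of f with 2/‖·‖. -/
open Real MeasureTheory
noncomputable section

/-- Partial derivative in the `i`-th coordinate direction. -/
def pd (i : Fin 3) (f : EuclideanSpace ℝ (Fin 3) → ℝ) :
    EuclideanSpace ℝ (Fin 3) → ℝ :=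
  fun v => fderiv ℝ f v (EuclideanSpace.single i 1)

/-- The Laplacian `Δf = Σ_j ∂_j² f`. -/
def lap (f : EuclideanSpace ℝ (Fin 3) → ℝ) : EuclideanSpace ℝ (Fin 3) → ℝ :=
  fun v => ∑ j, pd j (pd j f) v

abbrev E3 := EuclideanSpace ℝ (Fin 3)

lemma pd_contDiff {f : E3 → ℝ} (hf : ContDiff ℝ (⊤ : ℕ∞) f) (j : Fin 3) :
    ContDiff ℝ (⊤ : ℕ∞) (pd j f) := by
  unfold pd
  exact (hf.fderiv_right (m := (⊤ : ℕ∞)) (by simp)).clm_apply contDiff_const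

lemma pd_supp {f : E3 → ℝ} (hf : HasCompactSupport f) (j : Fin 3) :
    HasCompactSupport (pd j f) := by
  unfold pd
  exact hf.fderiv_apply ℝ _

lemma comp_supp {h : E3 → ℝ} (hs : HasCompactSupport h) (v : E3) :
    HasCompactSupport (fun u => h (v - u)) :=
  hs.comp_homeomorph (Homeomorph.subLeft v)

lemma pd_conv {f : E3 → ℝ} (hf : ContDiff ℝ (⊤ : ℕ∞) f) (hs : HasCompactSupport f) (j : Fin 3) :
    pd j (fun x => ∫ u, ‖u‖ * f (x - u)) = fun x => ∫ u, ‖u‖ * pd j f (x - u) := by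
  funext x
  have hl : LocallyIntegrable (fun u : E3 => ‖u‖) volume := continuous_norm.locallyIntegrable
  have h := hs.hasFDerivAt_convolution_right (ContinuousLinearMap.mul ℝ ℝ) (μ := volume) hl
    (hf.of_le (by simp)) x
  have h2 := congrArg (fun L => L (EuclideanSpace.single j 1)) h.fderiv
  refine h2.trans ?_
  beta_reduce
  rw [convolution_precompR_apply _ hl (hs.fderiv ℝ) (hf.continuous_fderiv (by simp))]
  simp [convolution_def, pd]

lemma ibp {φ h : E3 → ℝ} (hφ : ContDiff ℝ (⊤ : ℕ∞) φ) (hh : ContDiff ℝ (⊤ : ℕ∞) h)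
    (hs : HasCompactSupport h) (v : E3) (j : Fin 3) :
    ∫ u, φ u * pd j h (v - u) = ∫ u, pd j φ u * h (v - u) := by
  have hd : ∀ u, fderiv ℝ (fun u => h (v - u)) u (EuclideanSpace.single j 1) = - pd j h (v - u) := by
    intro u
    have h1 : HasFDerivAt (fun u => h (v - u)) _ u :=
      ((hh.differentiable (by simp)) (v - u)).hasFDerivAt.comp u ((hasFDerivAt_id u).const_sub v)
    rw [h1.fderiv]
    simp [pd]
  have hInteg : ∀ a b : E3 → ℝ, Continuous a → Continuous b → HasCompactSupport b →
      Integrable (fun u => a u * b (v - u)) := by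
    intro a b ha hb hbs
    exact (ha.mul (hb.comp (by fun_prop))).integrable_of_hasCompactSupport
      (comp_supp hbs v).mul_left
  have hpc := (pd_contDiff hh j).continuous
  have := integral_mul_fderiv_eq_neg_fderiv_mul_of_integrable (μ := volume) (f := φ)
    (g := fun u => h (v - u)) (v := EuclideanSpace.single j (1:ℝ))
    (hInteg _ _ (pd_contDiff hφ j).continuous hh.continuous hs)
    (by simp only [hd, mul_neg]; exact (hInteg _ _ hφ.continuous hpc (pd_supp hs j)).neg)
    (hInteg _ _ hφ.continuous hh.continuous hs)
    (fun x _ => hφ.differentiable (by simp) x)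
    (fun x _ => (hh.comp (contDiff_const.sub contDiff_id)).differentiable (by simp) x)
  simp only [hd, mul_neg, integral_neg] at this
  exact neg_injective this

def psi (e : ℝ) (u : E3) : ℝ := √(‖u‖ ^ 2 + e)

lemma psi_pos {e : ℝ} (he : 0 < e) (u : E3) : 0 < psi e u := by
  unfold psi; positivity

lemma psi_sq {e : ℝ} (he : 0 < e) (u : E3) : psi e u ^ 2 = ‖u‖ ^ 2 + e := by
  unfold psi; exact Real.sq_sqrt (by positivity)

lemma psi_contDiff {e : ℝ} (he : 0 < e) : ContDiff ℝ (⊤ : ℕ∞) (psi e) := by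
  unfold psi
  exact ((contDiff_norm_sq ℝ).add contDiff_const).sqrt (fun u => by positivity)

lemma psi_fderiv {e : ℝ} (he : 0 < e) (u : E3) :
    HasFDerivAt (psi e) ((psi e u)⁻¹ • innerSL ℝ u) u := by
  have h := (((hasStrictFDerivAt_norm_sq u).hasFDerivAt.add_const e)).sqrt
    (by positivity)
  have h2 : (psi e u)⁻¹ • innerSL ℝ u = (1 / (2 * √(‖u‖ ^ 2 + e))) • 2 • innerSL ℝ u := by
    ext w
    simp [psi]
    ring
  rw [h2]
  exact h

lemma psi_pd {e : ℝ} (he : 0 < e) (j : Fin 3) :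
    pd j (psi e) = fun u => (psi e u)⁻¹ * u j := by
  funext u
  simp [pd, (psi_fderiv he u).fderiv, EuclideanSpace.inner_single_right]

lemma psi_pd2 {e : ℝ} (he : 0 < e) (j : Fin 3) (u : E3) :
    pd j (pd j (psi e)) u = (psi e u)⁻¹ - u j ^ 2 * ((psi e u)⁻¹) ^ 3 := by
  rw [psi_pd he]
  have h1 : HasFDerivAt (fun u => (psi e u)⁻¹) _ u :=
    (hasDerivAt_inv (psi_pos he u).ne').comp_hasFDerivAt u (psi_fderiv he u)
  have h2 : HasFDerivAt (fun u : E3 => u j) _ u :=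
    (EuclideanSpace.proj (𝕜 := ℝ) j : E3 →L[ℝ] ℝ).hasFDerivAt
  have h3 : HasFDerivAt (fun u => (psi e u)⁻¹ * u j) _ u := h1.mul h2
  unfold pd
  rw [h3.fderiv]
  simp [EuclideanSpace.inner_single_right]
  have := psi_pos he u
  field_simp
  ring

lemma psi_lap {e : ℝ} (he : 0 < e) (u : E3) :
    lap (psi e) u = 2 * (psi e u)⁻¹ + e * ((psi e u)⁻¹) ^ 3 := by
  have h := psi_sq he u
  have hp := psi_pos he u
  rw [EuclideanSpace.real_norm_sq_eq] at h
  simp only [lap, psi_pd2 he, Fin.sum_univ_three] at h ⊢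
  field_simp
  linarith

lemma norm_inv_int {h : E3 → ℝ} (hh : Continuous h) (hs : HasCompactSupport h) :
    Integrable (fun u => ‖u‖⁻¹ * h u) := by
  obtain ⟨R, hR⟩ := hs.isCompact.isBounded.subset_closedBall (0 : E3)
  obtain ⟨C, hC⟩ := hs.exists_bound_of_continuous hh
  have h1 : Integrable (fun u : E3 => (Set.Iic R).indicator (fun r : ℝ => r⁻¹) ‖u‖) := by
    rw [integrable_fun_norm_addHaar volume (f := (Set.Iic R).indicator (fun r : ℝ => r⁻¹))]
    have : IntegrableOn (fun r : ℝ => r) (Set.Ioc 0 R) :=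
      (continuous_id.integrableOn_Icc).mono_set Set.Ioc_subset_Icc_self
    rw [← integrable_indicator_iff measurableSet_Ioc] at this
    rw [← integrable_indicator_iff measurableSet_Ioi]
    convert this using 1
    funext r
    by_cases h0 : 0 < r <;> by_cases h2 : r ≤ R <;> simp [Set.indicator, h0, h2]
    field_simp
  refine (h1.mul_const C).mono' ?_ (Filter.Eventually.of_forall fun u => ?_)
  · exact (measurable_norm.inv.mul hh.measurable).aestronglyMeasurable
  · by_cases hu : ‖u‖ ≤ R
    · simp only [Set.indicator, Set.mem_Iic, hu, if_true, norm_mul, norm_inv, norm_norm]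
      gcongr
      exact hC u
    · have : h u = 0 := by
        by_contra h0
        exact hu (by simpa using hR (subset_tsupport _ h0))
      simp [this, Set.indicator, hu]

theorem laplacian_rosenbluth_eq_conv
    (f : EuclideanSpace ℝ (Fin 3) → ℝ)
    (hf : ContDiff ℝ (⊤ : ℕ∞) f) (hsupp : HasCompactSupport f)
    (v : EuclideanSpace ℝ (Fin 3)) :
    lap (fun x => ∫ u, ‖u‖ * f (x - u)) v = ∫ w, (2 / ‖v - w‖) * f w := by
  have hgc : Continuous (fun u => f (v - u)) := hf.continuous.comp (by fun_prop)
  have hgs := comp_supp hsupp v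
  have hlc : Continuous (lap f) :=
    continuous_finsetSum _ fun j _ => (pd_contDiff (pd_contDiff hf j) j).continuous
  have hls : HasCompactSupport (lap f) := by
    have : lap f = pd 0 (pd 0 f) + pd 1 (pd 1 f) + pd 2 (pd 2 f) := by
      funext u; simp [lap, Fin.sum_univ_three]
    rw [this]
    exact ((pd_supp (pd_supp hsupp 0) 0).add (pd_supp (pd_supp hsupp 1) 1)).add
      (pd_supp (pd_supp hsupp 2) 2)
  have hInteg : ∀ a b : E3 → ℝ, Continuous a → Continuous b → HasCompactSupport b →
      Integrable (fun u => a u * b (v - u)) := by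
    intro a b ha hb hbs
    exact (ha.mul (hb.comp (by fun_prop))).integrable_of_hasCompactSupport
      (comp_supp hbs v).mul_left
  have e1 : lap (fun x => ∫ u, ‖u‖ * f (x - u)) v = ∫ u, ‖u‖ * lap f (v - u) := by
    simp only [lap, pd_conv hf hsupp, pd_conv (pd_contDiff hf _) (pd_supp hsupp _), Finset.mul_sum]
    rw [integral_finsetSum]
    exact fun j _ => hInteg _ _ continuous_norm (pd_contDiff (pd_contDiff hf j) j).continuous
      (pd_supp (pd_supp hsupp j) j)
  have e2 : ∀ e : ℝ, 0 < e → ∫ u, psi e u * lap f (v - u) = ∫ u, lap (psi e) u * f (v - u) := by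
    intro e he
    have hp := psi_contDiff he
    simp only [lap, Finset.mul_sum, Finset.sum_mul]
    rw [integral_finsetSum, integral_finsetSum]
    · refine Finset.sum_congr rfl fun j _ => ?_
      rw [ibp hp (pd_contDiff hf j) (pd_supp hsupp j), ibp (pd_contDiff hp j) hf hsupp]
    · exact fun j _ => hInteg _ _ (pd_contDiff (pd_contDiff hp j) j).continuous hf.continuous hsupp
    · exact fun j _ => hInteg _ _ hp.continuous (pd_contDiff (pd_contDiff hf j) j).continuous
        (pd_supp (pd_supp hsupp j) j)
  have hpt : ∀ u, Filter.Tendsto (fun e => psi e u) (nhdsWithin 0 (Set.Ioi 0)) (nhds ‖u‖) := by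
    intro u
    have : Continuous (fun e => psi e u) := by unfold psi; fun_prop
    have h := this.tendsto 0
    simp only [psi, add_zero, norm_nonneg, Real.sqrt_sq] at h
    exact h.mono_left nhdsWithin_le_nhds
  have t1 : Filter.Tendsto (fun e => ∫ u, psi e u * lap f (v - u)) (nhdsWithin 0 (Set.Ioi 0))
      (nhds (∫ u, ‖u‖ * lap f (v - u))) := by
    refine tendsto_integral_filter_of_dominated_convergence
      (fun u => ‖(‖u‖ + 1) * lap f (v - u)‖) ?_ ?_ ?_ ?_
    · filter_upwards [self_mem_nhdsWithin] with e he
      exact (hInteg _ _ (psi_contDiff he).continuous hlc hls).aestronglyMeasurable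
    · filter_upwards [Ioo_mem_nhdsGT (zero_lt_one' ℝ)] with e he
      refine Filter.Eventually.of_forall fun u => ?_
      rw [norm_mul, norm_mul]
      gcongr
      rw [Real.norm_of_nonneg (psi_pos he.1 u).le, Real.norm_of_nonneg (by positivity)]
      refine Real.sqrt_le_iff.2 ⟨by positivity, ?_⟩
      nlinarith [norm_nonneg u, he.2]
    · exact (hInteg (fun u => ‖u‖ + 1) _ (by fun_prop) hlc hls).norm
    · exact Filter.Eventually.of_forall fun u => (hpt u).mul_const _
  have t2 : Filter.Tendsto (fun e => ∫ u, lap (psi e) u * f (v - u)) (nhdsWithin 0 (Set.Ioi 0))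
      (nhds (∫ u, 2 / ‖u‖ * f (v - u))) := by
    refine tendsto_integral_filter_of_dominated_convergence
      (fun u => 3 * ‖‖u‖⁻¹ * f (v - u)‖) ?_ ?_ ?_ ?_
    · filter_upwards [self_mem_nhdsWithin] with e he
      refine (hInteg _ _ ?_ hf.continuous hsupp).aestronglyMeasurable
      exact continuous_finsetSum _ fun j _ =>
        (pd_contDiff (pd_contDiff (psi_contDiff he) j) j).continuous
    · filter_upwards [self_mem_nhdsWithin] with e he
      have he : 0 < e := he
      have hne : ∀ᵐ u : E3, u ≠ 0 := by simp [ae_iff]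
      filter_upwards [hne] with u hu
      have hu : 0 < ‖u‖ := norm_pos_iff.2 hu
      have hp := psi_pos he u
      have hq := psi_sq he u
      have hle : ‖u‖ ≤ psi e u := Real.le_sqrt_of_sq_le (by linarith)
      rw [norm_mul, norm_mul, ← mul_assoc]
      gcongr
      rw [psi_lap he, Real.norm_of_nonneg (by positivity), Real.norm_of_nonneg (by positivity)]
      have h1 : (psi e u)⁻¹ ≤ ‖u‖⁻¹ := by gcongr
      have h2 : e * ((psi e u)⁻¹) ^ 3 ≤ (psi e u)⁻¹ := by
        field_simp
        nlinarith
      linarith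
    · exact ((norm_inv_int hgc hgs).norm).const_mul 3
    · have hne : ∀ᵐ u : E3, u ≠ 0 := by simp [ae_iff]
      filter_upwards [hne] with u hu
      have hu : ‖u‖ ≠ 0 := norm_ne_zero_iff.2 hu
      have hi := (hpt u).inv₀ hu
      have he : Filter.Tendsto (fun e : ℝ => e) (nhdsWithin 0 (Set.Ioi 0)) (nhds 0) :=
        nhdsWithin_le_nhds
      have := ((hi.const_mul 2).add (he.mul (hi.pow 3))).mul_const (f (v - u))
      rw [zero_mul, add_zero, ← div_eq_mul_inv] at this
      refine this.congr' ?_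
      filter_upwards [self_mem_nhdsWithin] with e he
      rw [psi_lap he]
  have e3 := tendsto_nhds_unique (t1.congr' (by
    filter_upwards [self_mem_nhdsWithin] with e he using e2 e he)) t2
  rw [e1, e3, ← integral_sub_left_eq_self (fun w => 2 / ‖v - w‖ * f w) volume v]
  simp
end
end

section
/- Let f : ℝ³ → ℝ be smooth with compact support, let ψ(z) = ‖z‖, g = ψ⋆f, and define the Coulombian Landau operator C(f,f)(v) = ∇·(∇²g(v) ∇f(v) − ∇(Δg)(v) f(v)). Then kinetic energy is conserved: ∫_{ℝ³} C(f,f)(v) ‖v‖² dv = 0. -/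
open Real MeasureTheory
noncomputable section

/-- The Coulombian Landau operator in Rosenbluth form:
`∇·(∇²g ∇f − ∇(Δg) f)`. -/
def landauOp (g f : EuclideanSpace ℝ (Fin 3) → ℝ)
    (v : EuclideanSpace ℝ (Fin 3)) : ℝ :=
  ∑ i, pd i (fun w => (∑ j, pd i (pd j g) w * pd j f w) - pd i (lap g) w * f w) v

/-- Convolution with the norm. -/
def Psi (b : E3 → ℝ) : E3 → ℝ := fun x => ∫ u, ‖u‖ * b (x - u)

/-- Euler field. -/
def eul (b : E3 → ℝ) : E3 → ℝ := fun x => ∑ i, x i * pd i b x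

abbrev Sm (b : E3 → ℝ) : Prop := ContDiff ℝ (⊤ : ℕ∞) b

lemma Sm.pd {b : E3 → ℝ} (hb : Sm b) (i : Fin 3) : Sm (pd i b) := by
  unfold Sm _root_.pd
  have : ContDiff ℝ (⊤ : ℕ∞) (fderiv ℝ b) := hb.fderiv_right (by simp)
  exact this.clm_apply contDiff_const

lemma sm_coord (i : Fin 3) : Sm (fun x : E3 => x i) := by
  unfold Sm; fun_prop

lemma Sm.eul {b : E3 → ℝ} (hb : Sm b) : Sm (eul b) := by
  unfold Sm _root_.eul
  exact ContDiff.sum fun i _ => (sm_coord i).mul (hb.pd i)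

lemma Sm.dif {b : E3 → ℝ} (hb : Sm b) : Differentiable ℝ b :=
  hb.differentiable (by simp)

lemma cs_pd {b : E3 → ℝ} (hb : HasCompactSupport b) (i : Fin 3) :
    HasCompactSupport (pd i b) := hb.fderiv_apply ℝ _

lemma cs_eul {b : E3 → ℝ} (hb : HasCompactSupport b) : HasCompactSupport (eul b) := by
  unfold eul
  simp only [Fin.sum_univ_three]
  exact (((cs_pd hb 0).mul_left).add ((cs_pd hb 1).mul_left)).add ((cs_pd hb 2).mul_left)

lemma int_mul {a b : E3 → ℝ} (ha : Continuous a) (hb : Continuous b)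
    (hs : HasCompactSupport a) : Integrable (fun x => a x * b x) :=
  (ha.mul hb).integrable_of_hasCompactSupport hs.mul_right

lemma ibp_s13 {a b : E3 → ℝ} (ha : Sm a) (hb : Sm b) (hs : HasCompactSupport a) (i : Fin 3) :
    ∫ x, a x * pd i b x = - ∫ x, pd i a x * b x := by
  apply integral_mul_fderiv_eq_neg_fderiv_mul_of_integrable
  · exact int_mul (ha.pd i).continuous hb.continuous (cs_pd hs i)
  · exact int_mul ha.continuous (hb.pd i).continuous hs
  · exact int_mul ha.continuous hb.continuous hs
  · exact fun x _ => ha.dif x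
  · exact fun x _ => hb.dif x

lemma pd_mul {a b : E3 → ℝ} (ha : Sm a) (hb : Sm b) (i : Fin 3) (x : E3) :
    pd i (fun y => a y * b y) x = a x * pd i b x + pd i a x * b x := by
  unfold pd
  rw [fderiv_fun_mul (ha.dif x) (hb.dif x)]
  simp [mul_comm]

lemma pd_coord (i j : Fin 3) (x : E3) :
    pd i (fun y : E3 => y j) x = if i = j then 1 else 0 := by
  unfold pd
  have : HasFDerivAt (fun y : E3 => y j) (EuclideanSpace.proj j : E3 →L[ℝ] ℝ) x :=
    (EuclideanSpace.proj j : E3 →L[ℝ] ℝ).hasFDerivAt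
  rw [this.fderiv]
  simp [Pi.single_apply, eq_comm]

lemma pd_add {a b : E3 → ℝ} (ha : Sm a) (hb : Sm b) (i : Fin 3) (x : E3) :
    pd i (fun y => a y + b y) x = pd i a x + pd i b x := by
  unfold pd
  rw [fderiv_fun_add (ha.dif x) (hb.dif x)]
  simp

lemma pd_sum {a : Fin 3 → E3 → ℝ} (ha : ∀ k, Sm (a k)) (i : Fin 3) (x : E3) :
    pd i (fun y => ∑ k, a k y) x = ∑ k, pd i (a k) x := by
  unfold pd
  rw [fderiv_fun_sum (fun k _ => (ha k).dif x)]
  simp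

lemma pd_comm {b : E3 → ℝ} (hb : Sm b) (i j : Fin 3) : pd i (pd j b) = pd j (pd i b) := by
  funext x
  have h2 : DifferentiableAt ℝ (fderiv ℝ b) x :=
    (hb.fderiv_right (m := (⊤ : ℕ∞)) (by simp)).differentiable (by simp) x
  have key : ∀ v w : E3, fderiv ℝ (fun y => fderiv ℝ b y v) x w = fderiv ℝ (fderiv ℝ b) x w v := by
    intro v w
    rw [fderiv_clm_apply h2 (differentiableAt_const v)]
    simp
  unfold pd
  rw [key, key]
  have hs : IsSymmSndFDerivAt ℝ b x :=
    (hb.contDiffAt).isSymmSndFDerivAt (by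
      rw [minSmoothness_of_isRCLikeNormedField]
      exact WithTop.coe_le_coe.mpr (le_top : (2 : ℕ∞) ≤ ⊤))
  exact hs _ _

lemma pd_eul {b : E3 → ℝ} (hb : Sm b) (j : Fin 3) (x : E3) :
    pd j (eul b) x = eul (pd j b) x + pd j b x := by
  unfold eul
  rw [pd_sum (fun k => (sm_coord k).mul (hb.pd k))]
  simp_rw [pd_mul (sm_coord _) (hb.pd _), pd_coord, pd_comm hb j]
  rw [Finset.sum_add_distrib]
  simp

lemma pd_Psi_sm {b : E3 → ℝ} (hb : Sm b) (hs : HasCompactSupport b) :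
    Sm (Psi b) ∧ ∀ i, pd i (Psi b) = Psi (pd i b) := by
  have hn : LocallyIntegrable (fun u : E3 => ‖u‖) := continuous_norm.locallyIntegrable
  have e : ∀ c, Psi c = convolution (fun u : E3 => ‖u‖) c (ContinuousLinearMap.mul ℝ ℝ) volume :=
    fun c => rfl
  refine ⟨?_, fun i => ?_⟩
  · rw [e]
    exact hs.contDiff_convolution_right _ hn hb
  · funext x
    have h1 : ContDiff ℝ 1 b := hb.of_le (by exact_mod_cast le_top)
    have := hs.hasFDerivAt_convolution_right (ContinuousLinearMap.mul ℝ ℝ) hn h1 x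
    rw [e, e]
    unfold pd
    rw [this.fderiv, convolution_precompR_apply _ hn (hs.fderiv ℝ) (h1.continuous_fderiv (by simp))]

lemma Psi_alt (b : E3 → ℝ) (x : E3) : Psi b x = ∫ y, ‖x - y‖ * b y := by
  unfold Psi
  rw [← integral_sub_left_eq_self (fun y => ‖x - y‖ * b y) volume x]
  simp

lemma Psi_symm {a b : E3 → ℝ} (ha : Continuous a) (hb : Continuous b)
    (hsa : HasCompactSupport a) (hsb : HasCompactSupport b) :
    ∫ x, a x * Psi b x = ∫ x, b x * Psi a x := by
  simp_rw [Psi_alt, ← integral_const_mul]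
  rw [integral_integral_swap_of_hasCompactSupport]
  · congr 1; ext y; congr 1; ext x
    rw [norm_sub_rev]; ring
  · simp only [Function.uncurry_def]; fun_prop
  · apply HasCompactSupport.of_support_subset_isCompact (hsa.isCompact.prod hsb.isCompact)
    rintro ⟨x, y⟩ h
    simp only [Function.uncurry_def, Function.mem_support, ne_eq, mul_eq_zero, not_or] at h
    exact ⟨subset_tsupport _ h.1, subset_tsupport _ h.2.2⟩

lemma q_hasFDeriv (i : Fin 3) (u : E3) :
    ∃ L : E3 →L[ℝ] ℝ, HasFDerivAt (fun u : E3 => ‖u‖ * u i) L u ∧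
      L (EuclideanSpace.single i 1) = ‖u‖ + u i ^ 2 / ‖u‖ := by
  have hc : HasFDerivAt (fun y : E3 => y i) (EuclideanSpace.proj i : E3 →L[ℝ] ℝ) u :=
    (EuclideanSpace.proj i : E3 →L[ℝ] ℝ).hasFDerivAt
  by_cases hu : u = 0
  · subst hu
    refine ⟨0, ?_, by simp⟩
    rw [hasFDerivAt_iff_isLittleO_nhds_zero]
    simp only [zero_add, norm_zero, zero_mul, sub_zero, zero_apply]
    have h1 : (fun h : E3 => ‖h‖) =O[nhds 0] (fun h : E3 => h) :=
      (Asymptotics.isBigO_refl _ _).norm_left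
    have h2 : (fun h : E3 => h i) =o[nhds 0] (fun _ : E3 => (1 : ℝ)) := by
      rw [Asymptotics.isLittleO_one_iff]
      have : Continuous (fun h : E3 => h i) := by fun_prop
      simpa using this.tendsto 0
    have := h1.norm_right.mul_isLittleO h2
    simp only [mul_one] at this
    exact this.of_norm_right
  · have hn : HasFDerivAt (fun y : E3 => ‖y‖) (‖u‖⁻¹ • innerSL ℝ u) u := by
      have h0 : ‖u‖ ^ 2 ≠ 0 := by positivity
      have := (hasStrictFDerivAt_norm_sq u).hasFDerivAt.sqrt h0
      simp only [Real.sqrt_sq (norm_nonneg _)] at this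
      have e : ‖u‖⁻¹ • innerSL ℝ u = (1 / (2 * ‖u‖)) • 2 • innerSL ℝ u := by
        rw [← Nat.cast_smul_eq_nsmul ℝ, smul_smul]
        congr 1
        push_cast
        field_simp
      rw [e]
      exact this
    refine ⟨_, hn.mul hc, ?_⟩
    have : ‖u‖ ≠ 0 := norm_ne_zero_iff.mpr hu
    simp [EuclideanSpace.inner_single_right]
    field_simp

lemma q_ibp {b : E3 → ℝ} (hb : Sm b) (hs : HasCompactSupport b) (x : E3) (i : Fin 3) :
    Integrable (fun u : E3 => u i ^ 2 / ‖u‖ * b (x - u)) ∧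
    ∫ u : E3, ‖u‖ * u i * pd i b (x - u) =
      ∫ u : E3, (‖u‖ + u i ^ 2 / ‖u‖) * b (x - u) := by
  have hc' : Sm (fun u => b (x - u)) := hb.comp (contDiff_const.sub contDiff_id)
  have hsc : HasCompactSupport (fun u => b (x - u)) :=
    hs.comp_homeomorph (Homeomorph.subLeft x)
  have hpc : ∀ u, pd i (fun u => b (x - u)) u = - pd i b (x - u) := by
    intro u
    unfold pd
    have h1 : HasFDerivAt (fun u : E3 => x - u) (-(ContinuousLinearMap.id ℝ E3)) u :=
      (hasFDerivAt_id u).const_sub x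
    have := ((hb.dif (x - u)).hasFDerivAt).comp u h1
    have h2 := this.fderiv
    simp only [Function.comp_def] at h2
    rw [h2]
    simp
  have hq : ∀ u : E3, fderiv ℝ (fun u : E3 => ‖u‖ * u i) u (EuclideanSpace.single i 1)
      = ‖u‖ + u i ^ 2 / ‖u‖ := by
    intro u
    obtain ⟨L, hL, h⟩ := q_hasFDeriv i u
    rw [hL.fderiv, h]
  have I1 : Integrable (fun u : E3 => ‖u‖ * b (x - u)) := by
    refine (int_mul hc'.continuous continuous_norm hsc).congr (.of_forall fun u => ?_)
    exact mul_comm _ _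
  have I2 : Integrable (fun u : E3 => u i ^ 2 / ‖u‖ * b (x - u)) := by
    refine I1.mono ?_ (.of_forall fun u => ?_)
    · apply Measurable.aestronglyMeasurable
      have := hc'.continuous.measurable
      have h3 : Measurable (fun u : E3 => u i) := (sm_coord i).continuous.measurable
      exact ((h3.pow_const 2).div measurable_norm).mul this
    · rw [norm_mul, norm_mul]
      gcongr
      rw [norm_norm, norm_div, norm_pow, norm_norm]
      apply div_le_of_le_mul₀ (norm_nonneg _) (norm_nonneg _)
      have := PiLp.norm_apply_le u i
      nlinarith [norm_nonneg (u i)]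
  refine ⟨I2, ?_⟩
  have key := integral_mul_fderiv_eq_neg_fderiv_mul_of_integrable (μ := (volume : Measure E3))
    (f := fun u : E3 => ‖u‖ * u i) (g := fun u => b (x - u)) (v := EuclideanSpace.single i 1)
    ?_ ?_ ?_ ?_ ?_
  · simp_rw [hq] at key
    change ∫ u : E3, ‖u‖ * u i * pd i (fun u => b (x - u)) u = _ at key
    simp_rw [hpc, mul_neg, integral_neg] at key
    linarith
  · simp_rw [hq, add_mul]
    exact I1.add I2
  · have := int_mul (hc'.pd i).continuous (continuous_norm.mul (sm_coord i).continuous) (cs_pd hsc i)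
    exact this.congr (.of_forall fun u => mul_comm _ _)
  · have := int_mul hc'.continuous (continuous_norm.mul (sm_coord i).continuous) hsc
    exact this.congr (.of_forall fun u => mul_comm _ _)
  · exact fun u _ => (q_hasFDeriv i u).choose_spec.1.differentiableAt
  · exact fun u _ => hc'.dif u

lemma eul_Psi {b : E3 → ℝ} (hb : Sm b) (hs : HasCompactSupport b) (x : E3) :
    eul (Psi b) x = Psi (eul b) x + 4 * Psi b x := by
  have cc : ∀ c : E3 → ℝ, Continuous c → HasCompactSupport c → ∀ w : E3 → ℝ, Continuous w →
      Integrable (fun u => w u * c (x - u)) := by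
    intro c hc hsc w hw
    have := int_mul (a := fun u => c (x - u)) (by fun_prop) hw
      (hsc.comp_homeomorph (Homeomorph.subLeft x))
    exact this.congr (.of_forall fun u => mul_comm _ _)
  have h1 : eul (Psi b) x = ∑ i, ∫ u : E3, ‖u‖ * (x i * pd i b (x - u)) := by
    unfold eul
    refine Finset.sum_congr rfl fun i _ => ?_
    rw [(pd_Psi_sm hb hs).2 i]
    unfold Psi
    rw [← integral_const_mul]
    congr 1; ext u; ring
  have h2 : Psi (eul b) x = ∑ i, ∫ u : E3, ‖u‖ * ((x i - u i) * pd i b (x - u)) := by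
    unfold Psi eul
    rw [← integral_finsetSum]
    · congr 1; ext u; rw [Finset.mul_sum]; rfl
    · intro i _
      have := cc _ (hb.pd i).continuous (cs_pd hs i) (fun u => ‖u‖ * (x i - u i))
        (by fun_prop)
      simpa only [mul_assoc] using this
  have h3 : eul (Psi b) x - Psi (eul b) x = ∑ i, ∫ u : E3, ‖u‖ * u i * pd i b (x - u) := by
    rw [h1, h2, ← Finset.sum_sub_distrib]
    refine Finset.sum_congr rfl fun i _ => ?_
    rw [← integral_sub]
    · congr 1; ext u; ring
    · have := cc _ (hb.pd i).continuous (cs_pd hs i) (fun u => ‖u‖ * x i) (by fun_prop)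
      simpa only [mul_assoc] using this
    · have := cc _ (hb.pd i).continuous (cs_pd hs i) (fun u => ‖u‖ * (x i - u i))
        (by fun_prop)
      simpa only [mul_assoc] using this
  have h4 : ∑ i, ∫ u : E3, ‖u‖ * u i * pd i b (x - u) = 4 * Psi b x := by
    simp_rw [fun i => (q_ibp hb hs x i).2]
    rw [← integral_finsetSum]
    · unfold Psi
      rw [← integral_const_mul]
      congr 1; ext u
      rw [← Finset.sum_mul, Finset.sum_add_distrib, ← Finset.sum_div]
      have : ∑ i, u i ^ 2 = ‖u‖ ^ 2 := by
        rw [EuclideanSpace.norm_sq_eq]; simp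
      rw [this]
      by_cases hu : ‖u‖ = 0
      · simp [hu]
      · simp; field_simp; ring
    · intro i _
      simp_rw [add_mul]
      exact (cc b hb.continuous hs _ continuous_norm).add (q_ibp hb hs x i).1
  linarith

/-- Integration by parts for the Euler field. -/
lemma ibp_eul {a b : E3 → ℝ} (ha : Sm a) (hb : Sm b) (hs : HasCompactSupport a) :
    ∫ x, eul a x * b x = -3 * (∫ x, a x * b x) - ∫ x, a x * eul b x := by
  have A : ∀ i, ∫ x : E3, a x * (x i * pd i b x) =
      - (∫ x, a x * b x) - ∫ x : E3, x i * pd i a x * b x := by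
    intro i
    have hxa : Sm (fun x : E3 => a x * x i) := ha.mul (sm_coord i)
    have := ibp_s13 hxa hb hs.mul_right i
    simp_rw [pd_mul ha (sm_coord i), pd_coord] at this
    simp only [if_true, mul_one, add_mul] at this
    rw [integral_add] at this
    · have e1 : ∫ x : E3, a x * (x i * pd i b x) = ∫ x : E3, a x * x i * pd i b x := by
        congr 1; ext x; ring
      have e2 : ∫ x : E3, x i * pd i a x * b x = ∫ x : E3, pd i a x * x i * b x := by
        congr 1; ext x; ring
      rw [e1, e2, this]; ring
    · exact int_mul ha.continuous hb.continuous hs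
    · exact int_mul ((ha.pd i).continuous.mul (sm_coord i).continuous) hb.continuous
        (cs_pd hs i).mul_right
  have B : ∫ x, a x * eul b x = ∑ i, ∫ x : E3, a x * (x i * pd i b x) := by
    unfold eul
    rw [← integral_finsetSum]
    · congr 1; ext x; rw [Finset.mul_sum]
    · exact fun i _ => int_mul ha.continuous ((sm_coord i).mul (hb.pd i)).continuous hs
  have C : ∫ x, eul a x * b x = ∑ i, ∫ x : E3, x i * pd i a x * b x := by
    unfold eul
    rw [← integral_finsetSum]
    · congr 1; ext x; rw [Finset.sum_mul]
    · exact fun i _ => int_mul ((sm_coord i).mul (ha.pd i)).continuous hb.continuous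
        (cs_pd hs i).mul_left
  rw [B, C]
  simp_rw [A]
  simp only [Fin.sum_univ_three]
  ring

lemma ibp2 {a b : E3 → ℝ} (ha : Sm a) (hb : Sm b) (hs : HasCompactSupport a) (j : Fin 3) :
    ∫ x, pd j (pd j a) x * b x = ∫ x, a x * pd j (pd j b) x := by
  have h1 := ibp_s13 (ha.pd j) hb (cs_pd hs j) j
  have h2 := ibp_s13 ha (hb.pd j) hs j
  linarith

/-- The virial identity, for each second derivative. -/
lemma virial {f : E3 → ℝ} (hf : Sm f) (hs : HasCompactSupport f) (j : Fin 3) :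
    2 * ∫ x, f x * eul (pd j (pd j (Psi f))) x = - ∫ x, f x * pd j (pd j (Psi f)) x := by
  obtain ⟨hg, hg1⟩ := pd_Psi_sm hf hs
  have hh : Sm (pd j (pd j f)) := (hf.pd j).pd j
  have hhs : HasCompactSupport (pd j (pd j f)) := cs_pd (cs_pd hs j) j
  have hφ : pd j (pd j (Psi f)) = Psi (pd j (pd j f)) := by
    rw [hg1, (pd_Psi_sm (hf.pd j) (cs_pd hs j)).2]
  have hφs : Sm (pd j (pd j (Psi f))) := (hg.pd j).pd j
  have Ps : Sm (Psi (eul (pd j (pd j f)))) := (pd_Psi_sm hh.eul (cs_eul hhs)).1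
  have s1 : ∫ x, f x * eul (pd j (pd j (Psi f))) x =
      (∫ x, f x * Psi (eul (pd j (pd j f))) x) + 4 * ∫ x, f x * pd j (pd j (Psi f)) x := by
    rw [← integral_const_mul, ← integral_add]
    · congr 1; ext x
      rw [hφ, eul_Psi hh hhs]; ring
    · exact int_mul hf.continuous Ps.continuous hs
    · exact (int_mul hf.continuous hφs.continuous hs).const_mul 4
  have s2 := Psi_symm hf.continuous hh.eul.continuous hs (cs_eul hhs)
  have s3 := ibp_eul hh hg hhs
  have s4 := ibp2 hf hg hs j
  have s5 := ibp2 hf hg.eul hs j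
  have s6 : pd j (pd j (eul (Psi f))) =
      fun x => eul (pd j (pd j (Psi f))) x + 2 * pd j (pd j (Psi f)) x := by
    have : pd j (eul (Psi f)) = fun x => eul (pd j (Psi f)) x + pd j (Psi f) x := by
      funext x; exact pd_eul hg j x
    rw [this]
    funext x
    rw [pd_add (hg.pd j).eul (hg.pd j), pd_eul (hg.pd j)]
    ring
  have s7 : ∫ x, f x * pd j (pd j (eul (Psi f))) x =
      (∫ x, f x * eul (pd j (pd j (Psi f))) x) + 2 * ∫ x, f x * pd j (pd j (Psi f)) x := by
    rw [← integral_const_mul, ← integral_add]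
    · congr 1; ext x
      rw [s6]; ring
    · exact int_mul hf.continuous hφs.eul.continuous hs
    · exact (int_mul hf.continuous hφs.continuous hs).const_mul 2
  linarith

lemma pd_normsq (i : Fin 3) (x : E3) : pd i (fun v : E3 => ‖v‖ ^ 2) x = 2 * x i := by
  unfold pd
  rw [(hasStrictFDerivAt_norm_sq x).hasFDerivAt.fderiv]
  simp [EuclideanSpace.inner_single_right]

lemma sm_normsq : Sm (fun v : E3 => ‖v‖ ^ 2) := contDiff_norm_sq ℝ

lemma energy_aux {f g : E3 → ℝ} (hf : Sm f) (hg : Sm g) (hs : HasCompactSupport f)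
    (hv : ∀ j, 2 * ∫ x, f x * eul (pd j (pd j g)) x = - ∫ x, f x * pd j (pd j g) x) :
    ∫ v, landauOp g f v * ‖v‖ ^ 2 = 0 := by
  have hlap : Sm (lap g) := ContDiff.sum fun j _ => (hg.pd j).pd j
  -- flux
  set F : Fin 3 → E3 → ℝ := fun i w =>
    (∑ j, pd i (pd j g) w * pd j f w) - pd i (lap g) w * f w with hF
  have hFs : ∀ i, Sm (F i) := fun i =>
    (ContDiff.sum fun j _ => ((hg.pd j).pd i).mul (hf.pd j)).sub ((hlap.pd i).mul hf)
  have hFc : ∀ i, HasCompactSupport (F i) := by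
    intro i
    simp only [hF, Fin.sum_univ_three]
    exact ((((cs_pd hs 0).mul_left).add ((cs_pd hs 1).mul_left)).add
      ((cs_pd hs 2).mul_left)).sub hs.mul_left
  have h1 : ∫ v, landauOp g f v * ‖v‖ ^ 2 = ∑ i, - ∫ v : E3, F i v * (2 * v i) := by
    unfold landauOp
    simp_rw [Finset.sum_mul]
    rw [integral_finsetSum]
    · refine Finset.sum_congr rfl fun i _ => ?_
      have := ibp_s13 (hFs i) sm_normsq (hFc i) i
      simp_rw [pd_normsq] at this
      rw [this, neg_neg]
    · exact fun i _ => int_mul ((hFs i).pd i).continuous sm_normsq.continuous (cs_pd (hFc i) i)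
  -- the term with the gradient of f, integrated by parts
  have h2 : ∀ i j, ∫ v : E3, pd j f v * (v i * pd i (pd j g) v) =
      -(∫ v : E3, f v * ((if j = i then 1 else 0) * pd i (pd j g) v))
      - ∫ v : E3, f v * (v i * pd i (pd j (pd j g)) v) := by
    intro i j
    have hb : Sm (fun v : E3 => v i * pd i (pd j g) v) := (sm_coord i).mul ((hg.pd j).pd i)
    have := ibp_s13 hf hb hs j
    simp_rw [pd_mul (sm_coord i) ((hg.pd j).pd i), pd_coord, pd_comm (hg.pd j) j i, mul_add] at this
    rw [integral_add] at this
    · linarith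
    · exact int_mul hf.continuous ((sm_coord i).mul (((hg.pd j).pd j).pd i)).continuous hs
    · exact int_mul hf.continuous (continuous_const.mul ((hg.pd j).pd i).continuous) hs
  have h3 : ∀ i, ∫ v : E3, F i v * (2 * v i) =
      ∑ j, 2 * ((∫ v : E3, pd j f v * (v i * pd i (pd j g) v)) -
        ∫ v : E3, f v * (v i * pd i (pd j (pd j g)) v)) := by
    intro i
    have hl : ∀ v, pd i (lap g) v = ∑ j, pd i (pd j (pd j g)) v := fun v =>
      pd_sum (fun k => (hg.pd k).pd k) i v
    have I1 : ∀ j, Integrable (fun v : E3 => pd j f v * (v i * pd i (pd j g) v)) := fun j =>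
      int_mul (hf.pd j).continuous ((sm_coord i).mul ((hg.pd j).pd i)).continuous (cs_pd hs j)
    have I2 : ∀ j, Integrable (fun v : E3 => f v * (v i * pd i (pd j (pd j g)) v)) := fun j =>
      int_mul hf.continuous ((sm_coord i).mul (((hg.pd j).pd j).pd i)).continuous hs
    simp_rw [← fun j => integral_sub (I1 j) (I2 j), ← integral_const_mul]
    rw [← integral_finsetSum]
    · congr 1; ext v
      simp only [hF, hl, Fin.sum_univ_three]
      ring
    · exact fun j _ => ((I1 j).sub (I2 j)).const_mul 2
  have h4 : ∀ j, ∫ x, f x * eul (pd j (pd j g)) x =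
      ∑ i, ∫ v : E3, f v * (v i * pd i (pd j (pd j g)) v) := by
    intro j
    unfold eul
    rw [← integral_finsetSum]
    · congr 1; ext x; rw [Finset.mul_sum]
    · exact fun i _ =>
        int_mul hf.continuous ((sm_coord i).mul (((hg.pd j).pd j).pd i)).continuous hs
  have v0 := hv 0
  have v1 := hv 1
  have v2 := hv 2
  rw [h4, Fin.sum_univ_three] at v0 v1 v2
  rw [h1]
  simp_rw [h3, h2, Fin.sum_univ_three]
  simp
  linarith

/-- For `f` smooth with compact support, the Coulombian Landau
operator `C(f,f) = ∇·(∇²g ∇f − ∇(Δg) f)` with `g = ψ⋆f` conserves kinetic energy: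
`∫ C(f,f)(v) ‖v‖² dv = 0`. -/
theorem landauOp_conserves_energy
    (f : EuclideanSpace ℝ (Fin 3) → ℝ)
    (hf : ContDiff ℝ (⊤ : ℕ∞) f) (hsupp : HasCompactSupport f) :
    ∫ v, landauOp (fun x => ∫ u, ‖u‖ * f (x - u)) f v * ‖v‖ ^ 2 = 0 := by
  exact energy_aux hf (pd_Psi_sm hf hsupp).1 hsupp (virial hf hsupp)
end
end
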